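/- arXiv:2309.16998 — 2 statements merged into one kernel-verified Lean document; each statement's English description precedes it below -/
import Mathlib

section
/- Let n ≥ 1 and let R be a subalgebra of PŁ_n × PŁ_n with R ⊆ ≤, containing some pair (x,y) with x ≠ y (i.e., R is not the diagonal of a subalgebra of PŁ_n), and put S = pr₁(R) × pr₂(R). Then for every (x,y) ∈ R, the set C_{(x,y),S} = {(x',y') ∈ S : x' ≤ x and y ≤ y'} is contained in R. -/
/-- Truncated product on the positive MV-chain `{0,…,n}`:
`x ⊙ y = max (0, x + y - n)` (ℕ-subtraction is truncated). -/
def plOdot (n x y : ℕ) : ℕ := x + y - n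

/-- Truncated sum on the positive MV-chain `{0,…,n}`: `x ⊕ y = min (n, x + y)`. -/
def plOplus (n x y : ℕ) : ℕ := min n (x + y)

/-- `L` is a subalgebra of the positive MV-chain `PŁ_n`: a subset of `{0,…,n}`
containing `0` and `n` and closed under `∧, ∨, ⊙, ⊕`. -/
def IsSubalg (n : ℕ) (L : Set ℕ) : Prop :=
  (∀ x ∈ L, x ≤ n) ∧ 0 ∈ L ∧ n ∈ L ∧
  (∀ x ∈ L, ∀ y ∈ L, min x y ∈ L) ∧
  (∀ x ∈ L, ∀ y ∈ L, max x y ∈ L) ∧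
  (∀ x ∈ L, ∀ y ∈ L, plOdot n x y ∈ L) ∧
  (∀ x ∈ L, ∀ y ∈ L, plOplus n x y ∈ L)

/-- `R` is a subalgebra of `PŁ_n × PŁ_n` (componentwise operations). -/
def IsSubalgPair (n : ℕ) (R : Set (ℕ × ℕ)) : Prop :=
  (∀ p ∈ R, p.1 ≤ n ∧ p.2 ≤ n) ∧ (0, 0) ∈ R ∧ (n, n) ∈ R ∧
  (∀ p ∈ R, ∀ q ∈ R, (min p.1 q.1, min p.2 q.2) ∈ R) ∧
  (∀ p ∈ R, ∀ q ∈ R, (max p.1 q.1, max p.2 q.2) ∈ R) ∧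
  (∀ p ∈ R, ∀ q ∈ R, (plOdot n p.1 q.1, plOdot n p.2 q.2) ∈ R) ∧
  (∀ p ∈ R, ∀ q ∈ R, (plOplus n p.1 q.1, plOplus n p.2 q.2) ∈ R)

/-- Repeated squaring `x ↦ x ⊙ x` sends `(x, n)` with `x < n` to `(0, n)`. -/
theorem IsSubalgPair.zero_top_mem_of_top_mem {n : ℕ} {R : Set (ℕ × ℕ)} (hR : IsSubalgPair n R)
    (x : ℕ) (hx : x < n) (h : (x, n) ∈ R) : (0, n) ∈ R := by
  induction x using Nat.strong_induction_on with
  | _ x ih =>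
    obtain rfl | hx0 := Nat.eq_zero_or_pos x
    · exact h
    · obtain ⟨-, -, -, -, -, hodot, -⟩ := hR
      have h2 := hodot _ h _ h
      simp only [plOdot, Nat.add_sub_cancel] at h2
      exact ih (x + x - n) (by omega) (by omega) h2

/-- Doubling by `⊕` or `⊙` enlarges the gap of a pair `x < y` until it becomes `(0, n)`. -/
theorem IsSubalgPair.zero_top_mem {n : ℕ} {R : Set (ℕ × ℕ)} (hR : IsSubalgPair n R)
    {x y : ℕ} (hxy : x < y) (h : (x, y) ∈ R) : (0, n) ∈ R := by
  induction hk : n - (y - x) using Nat.strong_induction_on generalizing x y with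
  | _ k ih =>
    obtain ⟨hle, -, -, -, -, hodot, hoplus⟩ := id hR
    have hyn : y ≤ n := (hle _ h).2
    have h1 := hodot _ h _ h
    have h2 := hoplus _ h _ h
    simp only [plOdot, plOplus] at h1 h2
    by_cases hy : y + y ≤ n
    · rw [min_eq_right (by omega), min_eq_right hy] at h2
      exact ih _ (by omega) (by omega) h2 rfl
    by_cases hx : n ≤ x + x
    · exact ih _ (by omega) (by omega) h1 rfl
    rw [min_eq_right (by omega), min_eq_left (by omega)] at h2
    exact hR.zero_top_mem_of_top_mem _ (by omega) h2

/-- a non-diagonal subalgebra `R ⊆ ≤` of `PŁ_n × PŁ_n` is closed under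
the sets `C_{(x,y),S} = {(x',y') ∈ S : x' ≤ x ∧ y ≤ y'}` for `S = pr₁(R) × pr₂(R)`. -/
theorem subalgebra_closed_under_rectangles (n : ℕ) (hn : 1 ≤ n)
    (R : Set (ℕ × ℕ)) (hR : IsSubalgPair n R)
    (hle : R ⊆ {p : ℕ × ℕ | p.1 ≤ p.2})
    (hnd : ∃ p ∈ R, p.1 ≠ p.2) :
    ∀ p ∈ R,
      {q : ℕ × ℕ | q ∈ (Prod.fst '' R) ×ˢ (Prod.snd '' R) ∧ q.1 ≤ p.1 ∧ p.2 ≤ q.2}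
        ⊆ R := by
  obtain ⟨⟨a, b⟩, hab, hne⟩ := hnd
  have h0 : (0, n) ∈ R := hR.zero_top_mem (lt_of_le_of_ne (hle hab) hne) hab
  obtain ⟨hbd, -, -, hmin, hmax, -, -⟩ := hR
  rintro ⟨x, y⟩ hxy ⟨x', y'⟩ ⟨⟨⟨⟨_, u⟩, hu, rfl⟩, ⟨⟨v, _⟩, hv, rfl⟩⟩, hx, hy⟩
  have hun := (hbd _ hu).2
  have hvn := (hbd _ hv).2
  have hyn := (hbd _ hxy).2
  have h := hmax _ (hmin _ (hmax _ hu _ h0) _ hxy) _ (hmin _ hv _ h0)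
  simp only at hx hy hun hvn hyn h ⊢
  convert h using 2 <;> omega
end

section
/- Let n ≥ 1, let I be a set, and let A be a subalgebra of PŁ_n^I that is closed under τ_d applied pointwise for every d ∈ {0,…,n}. Let H denote the set of bounded lattice homomorphisms p : S(A) → {0,1} from the distributive skeleton S(A) = {a ∈ A : a ⊕ a = a} to the two-element lattice, and for p ∈ H define u_p : A → {0,…,n} by u_p(a) = max{d ∈ {0,…,n} : p(τ_d ∘ a) = 1}. Then the map A → ({0,…,n})^H sending a to the function p ↦ u_p(a) is an injective homomorphism: it sends the constant functions 0 and n to the constant functions 0 and n, preserves ∧, ∨, ⊙, ⊕ computed pointwise on ({0,…,n})^H, and is injective. In particular, every such A embeds into a power of PŁ_n indexed by the dual space of its distributive skeleton. -/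
/-- `τ_d : {0,…,n} → {0,…,n}` sends `x` to `n` if `d ≤ x` and to `0` otherwise. -/
def tau (n d x : ℕ) : ℕ := if d ≤ x then n else 0

/-- `A` is a subalgebra of the power `PŁ_nᴵ`: a set of functions `I → {0,…,n}`
containing the constant functions `0` and `n` and closed under pointwise
`∧, ∨, ⊙, ⊕`. -/
def IsSubalgPow (n : ℕ) {I : Type*} (A : Set (I → ℕ)) : Prop :=
  (∀ a ∈ A, ∀ i, a i ≤ n) ∧ (fun _ => 0) ∈ A ∧ (fun _ => n) ∈ A ∧
  (∀ a ∈ A, ∀ b ∈ A, (fun i => min (a i) (b i)) ∈ A) ∧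
  (∀ a ∈ A, ∀ b ∈ A, (fun i => max (a i) (b i)) ∈ A) ∧
  (∀ a ∈ A, ∀ b ∈ A, (fun i => plOdot n (a i) (b i)) ∈ A) ∧
  (∀ a ∈ A, ∀ b ∈ A, (fun i => plOplus n (a i) (b i)) ∈ A)

/-- `A` is closed under `τ_d` applied pointwise, for every `d ∈ {0,…,n}`. -/
def ClosedUnderTau (n : ℕ) {I : Type*} (A : Set (I → ℕ)) : Prop :=
  ∀ a ∈ A, ∀ d ≤ n, (fun i => tau n d (a i)) ∈ A

/-- Membership in the distributive skeleton `S(A) = {a ∈ A : a ⊕ a = a}`. -/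
def InSkeleton (n : ℕ) {I : Type*} (A : Set (I → ℕ)) (a : I → ℕ) : Prop :=
  a ∈ A ∧ (fun i => plOplus n (a i) (a i)) = a

/-- `p` is a bounded lattice homomorphism from the distributive skeleton `S(A)`
to the two-element lattice `{0,1}` (modelled as `Bool`). -/
def IsSkeletonHom (n : ℕ) {I : Type*} (A : Set (I → ℕ)) (p : (I → ℕ) → Bool) : Prop :=
  p (fun _ => 0) = false ∧ p (fun _ => n) = true ∧
  (∀ a b, InSkeleton n A a → InSkeleton n A b →
    p (fun i => min (a i) (b i)) = (p a && p b)) ∧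
  (∀ a b, InSkeleton n A a → InSkeleton n A b →
    p (fun i => max (a i) (b i)) = (p a || p b))

/-- `u_p(a) = max {d ∈ {0,…,n} : p (τ_d ∘ a) = 1}`. -/
noncomputable def uP (n : ℕ) {I : Type*} (p : (I → ℕ) → Bool) (a : I → ℕ) : ℕ :=
  sSup {d : ℕ | d ≤ n ∧ p (fun i => tau n d (a i)) = true}

section Skeleton

variable {n : ℕ} {I : Type*} {A : Set (I → ℕ)} {a b c : I → ℕ} {p : (I → ℕ) → Bool}

lemma InSkeleton.apply_eq (h : InSkeleton n A a) (i : I) : a i = 0 ∨ a i = n := by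
  have := congrFun h.2 i
  simp only [plOplus] at this
  omega

lemma inSkeleton_of_apply_eq (ha : a ∈ A) (h : ∀ i, a i = 0 ∨ a i = n) : InSkeleton n A a := by
  refine ⟨ha, funext fun i => ?_⟩
  have := h i
  simp only [plOplus]
  omega

lemma InSkeleton.min (hA : IsSubalgPow n A) (ha : InSkeleton n A a) (hb : InSkeleton n A b) :
    InSkeleton n A (fun i => min (a i) (b i)) := by
  refine inSkeleton_of_apply_eq (hA.2.2.2.1 a ha.1 b hb.1) fun i => ?_
  have := ha.apply_eq i
  have := hb.apply_eq i
  omega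

lemma InSkeleton.max (hA : IsSubalgPow n A) (ha : InSkeleton n A a) (hb : InSkeleton n A b) :
    InSkeleton n A (fun i => max (a i) (b i)) := by
  refine inSkeleton_of_apply_eq (hA.2.2.2.2.1 a ha.1 b hb.1) fun i => ?_
  have := ha.apply_eq i
  have := hb.apply_eq i
  omega

lemma inSkeleton_tau (hAtau : ClosedUnderTau n A) (ha : a ∈ A) {d : ℕ} (hd : d ≤ n) :
    InSkeleton n A (fun i => tau n d (a i)) := by
  refine inSkeleton_of_apply_eq (hAtau a ha d hd) fun i => ?_
  simp only [tau]
  split_ifs <;> simp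

/-- A homomorphism cannot separate `s` from `t` when `s ≤ t`. -/
lemma IsSkeletonHom.exists_lt (hp : IsSkeletonHom n A p) {s t : I → ℕ} (hs : InSkeleton n A s)
    (ht : InSkeleton n A t) (hps : p s = true) (hpt : p t = false) : ∃ i, t i < s i := by
  by_contra! h
  have := hp.2.2.1 s t hs ht
  simp [h, hps, hpt] at this

/-- The value `u_p(a)` is cut out by one skeleton element in the prime filter of `p`
and one outside of it. -/
lemma IsSkeletonHom.exists_cut (hp : IsSkeletonHom n A p) (hA : IsSubalgPow n A)
    (hAtau : ClosedUnderTau n A) (ha : a ∈ A) :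
    ∃ s t, InSkeleton n A s ∧ InSkeleton n A t ∧ p s = true ∧ p t = false ∧
      ∀ i, s i ≠ 0 → t i = 0 → a i = uP n p a := by
  set S : Set ℕ := {d : ℕ | d ≤ n ∧ p (fun i => tau n d (a i)) = true} with hS
  have hbdd : BddAbove S := ⟨n, fun d hd => hd.1⟩
  have hmem : uP n p a ∈ S :=
    Nat.sSup_mem ⟨0, Nat.zero_le n, by simpa [tau] using hp.2.1⟩ hbdd
  refine ⟨_, if uP n p a < n then fun i => tau n (uP n p a + 1) (a i) else fun _ => 0,
    inSkeleton_tau hAtau ha hmem.1, ?_, hmem.2, ?_, fun i hs ht => ?_⟩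
  · split_ifs with h
    · exact inSkeleton_tau hAtau ha h
    · exact inSkeleton_of_apply_eq hA.2.1 fun _ => Or.inl rfl
  · split_ifs with h
    · by_contra hne
      have : uP n p a + 1 ≤ uP n p a := le_csSup hbdd ⟨h, by simpa using hne⟩
      omega
    · exact hp.1
  · have hle := hA.1 a ha i
    have hge : uP n p a ≤ a i := by
      by_contra h
      simp [tau, h] at hs
    split_ifs at ht with h
    · simp only [tau] at ht
      split_ifs at ht <;> omega
    · omega

/-- Any three members of `A` take their values under `u_p` simultaneously at a single point. -/
lemma IsSkeletonHom.exists_apply_eq_uP (hp : IsSkeletonHom n A p) (hA : IsSubalgPow n A)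
    (hAtau : ClosedUnderTau n A) (ha : a ∈ A) (hb : b ∈ A) (hc : c ∈ A) :
    ∃ i, a i = uP n p a ∧ b i = uP n p b ∧ c i = uP n p c := by
  obtain ⟨s₁, t₁, hs₁, ht₁, ps₁, pt₁, h₁⟩ := hp.exists_cut hA hAtau ha
  obtain ⟨s₂, t₂, hs₂, ht₂, ps₂, pt₂, h₂⟩ := hp.exists_cut hA hAtau hb
  obtain ⟨s₃, t₃, hs₃, ht₃, ps₃, pt₃, h₃⟩ := hp.exists_cut hA hAtau hc
  obtain ⟨i, hi⟩ := hp.exists_lt (hs₁.min hA (hs₂.min hA hs₃)) (ht₁.max hA (ht₂.max hA ht₃))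
    (by rw [hp.2.2.1 _ _ hs₁ (hs₂.min hA hs₃), hp.2.2.1 _ _ hs₂ hs₃, ps₁, ps₂, ps₃]; rfl)
    (by rw [hp.2.2.2 _ _ ht₁ (ht₂.max hA ht₃), hp.2.2.2 _ _ ht₂ ht₃, pt₁, pt₂, pt₃]; rfl)
  have := hs₁.apply_eq i
  have := hs₂.apply_eq i
  have := hs₃.apply_eq i
  have := ht₁.apply_eq i
  have := ht₂.apply_eq i
  have := ht₃.apply_eq i
  exact ⟨i, h₁ i (by omega) (by omega), h₂ i (by omega) (by omega), h₃ i (by omega) (by omega)⟩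

/-- Every operation under which a pair in `A` stays in `A` is preserved by `u_p`. -/
lemma IsSkeletonHom.uP_map₂ (hp : IsSkeletonHom n A p) (hA : IsSubalgPow n A)
    (hAtau : ClosedUnderTau n A) (f : ℕ → ℕ → ℕ) (ha : a ∈ A) (hb : b ∈ A)
    (hf : (fun i => f (a i) (b i)) ∈ A) :
    uP n p (fun i => f (a i) (b i)) = f (uP n p a) (uP n p b) := by
  obtain ⟨i, h₁, h₂, h₃⟩ := hp.exists_apply_eq_uP hA hAtau ha hb hf
  rw [← h₁, ← h₂, ← h₃]

lemma IsSkeletonHom.uP_const (hp : IsSkeletonHom n A p) (hA : IsSubalgPow n A)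
    (hAtau : ClosedUnderTau n A) {k : ℕ} (hk : (fun _ => k) ∈ A) : uP n p (fun _ => k) = k :=
  hp.uP_map₂ hA hAtau (fun _ _ => k) hk hk hk

lemma isSkeletonHom_eval (hn : 1 ≤ n) (i : I) :
    IsSkeletonHom n A (fun a => decide (0 < a i)) := by
  refine ⟨by simp, by simpa using (show 0 < n from hn), fun a b _ _ => ?_, fun a b _ _ => ?_⟩
  · simp
  · simp

lemma uP_eval (hn : 1 ≤ n) {i : I} (hi : a i ≤ n) :
    uP n (fun a => decide (0 < a i)) a = a i := by
  have hS : {d : ℕ | d ≤ n ∧ decide (0 < tau n d (a i)) = true} = Set.Iic (a i) := by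
    ext d
    by_cases h : d ≤ a i <;> simp [tau, h]
    omega
  rw [uP, hS, csSup_Iic]

end Skeleton

/-- the evaluation map `a ↦ (p ↦ u_p(a))` is an injective homomorphism
from `A` into the power of `PŁ_n` indexed by the bounded lattice homomorphisms
`S(A) → {0,1}`, i.e. by the dual space of the distributive skeleton of `A`. -/
theorem embeds_into_power_over_skeleton_dual (n : ℕ) (hn : 1 ≤ n) {I : Type*}
    (A : Set (I → ℕ)) (hA : IsSubalgPow n A) (hAtau : ClosedUnderTau n A)
    (e : (I → ℕ) → ({p : (I → ℕ) → Bool // IsSkeletonHom n A p} → ℕ))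
    (he : ∀ a q, e a q = uP n q.1 a) :
    e (fun _ => 0) = (fun _ => 0) ∧
    e (fun _ => n) = (fun _ => n) ∧
    (∀ a ∈ A, ∀ b ∈ A,
      e (fun i => min (a i) (b i)) = fun q => min (e a q) (e b q)) ∧
    (∀ a ∈ A, ∀ b ∈ A,
      e (fun i => max (a i) (b i)) = fun q => max (e a q) (e b q)) ∧
    (∀ a ∈ A, ∀ b ∈ A,
      e (fun i => plOdot n (a i) (b i)) = fun q => plOdot n (e a q) (e b q)) ∧
    (∀ a ∈ A, ∀ b ∈ A,
      e (fun i => plOplus n (a i) (b i)) = fun q => plOplus n (e a q) (e b q)) ∧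
    (∀ a ∈ A, ∀ b ∈ A, e a = e b → a = b) := by
  refine ⟨funext fun q => ?_, funext fun q => ?_, fun a ha b hb => funext fun q => ?_,
    fun a ha b hb => funext fun q => ?_, fun a ha b hb => funext fun q => ?_,
    fun a ha b hb => funext fun q => ?_, fun a ha b hb hab => funext fun i => ?_⟩
  · rw [he, q.2.uP_const hA hAtau hA.2.1]
  · rw [he, q.2.uP_const hA hAtau hA.2.2.1]
  · simp only [he]
    exact q.2.uP_map₂ hA hAtau min ha hb (hA.2.2.2.1 a ha b hb)
  · simp only [he]
    exact q.2.uP_map₂ hA hAtau max ha hb (hA.2.2.2.2.1 a ha b hb)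
  · simp only [he]
    exact q.2.uP_map₂ hA hAtau (plOdot n) ha hb (hA.2.2.2.2.2.1 a ha b hb)
  · simp only [he]
    exact q.2.uP_map₂ hA hAtau (plOplus n) ha hb (hA.2.2.2.2.2.2 a ha b hb)
  · have h := congrFun hab ⟨_, isSkeletonHom_eval hn i⟩
    rwa [he, he, uP_eval hn (hA.1 a ha i), uP_eval hn (hA.1 b hb i)] at h
end
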